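/- Let g be even, Γ the bounded part of the tropical hyperelliptic curve of genus g, D* = (g/2)(V_0 + V_0′), and x, y the coordinate rational functions on Γ. For i ≥ 0 and any constants a, b ∈ ℝ: the rational function a + i·x belongs to R(3D*) if and only if 0 ≤ i ≤ 3g/2, and the rational function b + i·x + y belongs to R(3D*) if and only if 0 ≤ i ≤ g/2 − 1. Explicitly, (a + i·x) + 3D* = i(V_g + V_g′) + (3g/2 − i)(V_0 + V_0′) and (b + i·x + y) + 3D* = i(V_g + V_g′) + (5g/2 + 1 − i)V_0′ + (g/2 − 1 − i)V_0. -/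

import Mathlib

open scoped BigOperators

namespace TropicalHyperelliptic

/-! ## The tropical hyperelliptic curve

For a genus `g ≥ 1` and parameters `c₋₁, c₀, …, c_{g+1}` (encoded as a function
`c : ℤ → ℝ`; only the values `c (-1), …, c (g+1)` matter), the tropical
polynomial `F̃(X,Y) = max(2Y, Y + P̃(X), c₋₁)` with
`P̃(X) = max_{0 ≤ i ≤ g+1} (c_i + iX)` defines the tropical hyperelliptic curve
`Γ̄` as the locus of points of `ℝ²` where `F̃` fails to be differentiable. -/

/-- The tropical polynomial `P̃(X) = max_{0 ≤ i ≤ g+1} (c_i + i X)`. -/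
noncomputable def Ptilde (g : ℕ) (c : ℤ → ℝ) (X : ℝ) : ℝ :=
  (Finset.range (g + 2)).sup' (Finset.nonempty_range_iff.mpr (by omega))
    fun i => c (i : ℤ) + (i : ℝ) * X

/-- The tropical polynomial `F̃(X,Y) = max(2Y, Y + P̃(X), c₋₁)`. -/
noncomputable def Ftilde (g : ℕ) (c : ℤ → ℝ) (P : ℝ × ℝ) : ℝ :=
  max (2 * P.2) (max (P.2 + Ptilde g c P.1) (c (-1)))

/-- The tropical hyperelliptic curve `Γ̄` of genus `g`: the set of points of
`ℝ²` at which `F̃` is not differentiable. -/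
def curveBar (g : ℕ) (c : ℤ → ℝ) : Set (ℝ × ℝ) :=
  {P | ¬ DifferentiableAt ℝ (Ftilde g c) P}

/-- The hypotheses on the parameters: `c_{g+1} = c_g = 0`, `c₋₁ < 2c₀`,
`cᵢ + c_{i+2} < 2c_{i+1}` for `0 ≤ i ≤ g − 2`, and `c_{g−1} < 2c_g = 0`.
Under these assumptions `Γ̄` is a smooth tropical curve of genus `g`. -/
def Hyp (g : ℕ) (c : ℤ → ℝ) : Prop :=
  c ((g : ℤ) + 1) = 0 ∧ c (g : ℤ) = 0 ∧ c (-1) < 2 * c 0 ∧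
  (∀ i : ℕ, (i : ℤ) ≤ (g : ℤ) - 2 → c i + c ((i : ℤ) + 2) < 2 * c ((i : ℤ) + 1)) ∧
  c ((g : ℤ) - 1) < 0

/-- The vertices `V_i` (`0 ≤ i ≤ g`) of `Γ̄` lying above the line
`Y = c₋₁/2`:  `V_0 = (0,0)` and
`V_i = (c_{g−i} − c_{g−i+1}, (g−i+1)c_{g−i} − (g−i)c_{g−i+1})`.
(The formula below also gives `V_0 = (0,0)` for `i = 0`, since
`c_g = c_{g+1} = 0`.) -/
noncomputable def V (g : ℕ) (c : ℤ → ℝ) (i : ℕ) : ℝ × ℝ :=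
  (c ((g : ℤ) - i) - c ((g : ℤ) - i + 1),
   (((g : ℤ) - i + 1 : ℤ) : ℝ) * c ((g : ℤ) - i)
     - (((g : ℤ) - i : ℤ) : ℝ) * c ((g : ℤ) - i + 1))

/-- The conjugate `P′` of a point `P`: the reflection with respect to the line
`Y = c₋₁/2`. -/
def conj (c : ℤ → ℝ) (P : ℝ × ℝ) : ℝ × ℝ := (P.1, c (-1) - P.2)

/-- The metric graph `Γ` obtained from `Γ̄` by removing all unbounded edges:
the part of `Γ̄` lying in the vertical strip `x(V_g) ≤ X ≤ x(V_0) = 0`,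
where `x(V_g) = c_0 − c_1`. -/
def Gam (g : ℕ) (c : ℤ → ℝ) : Set (ℝ × ℝ) :=
  {P ∈ curveBar g c | c 0 - c 1 ≤ P.1 ∧ P.1 ≤ 0}

/-! ## Rational functions, orders, and divisors -/

/-- The image in `ℝ²` of an integer vector. -/
def vr (v : ℤ × ℤ) : ℝ × ℝ := ((v.1 : ℝ), (v.2 : ℝ))

/-- The primitive integer directions along which one can leave the point `P`
inside the set `S` (the outgoing directions of the segments of `S` emanating
from `P`). -/
def localDirs (S : Set (ℝ × ℝ)) (P : ℝ × ℝ) : Set (ℤ × ℤ) :=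
  {v | IsCoprime v.1 v.2 ∧ ∃ ε > (0 : ℝ), ∀ t : ℝ, 0 < t → t < ε → P + t • vr v ∈ S}

/-- `f` has (integer) outgoing slope `s` at `P` in the direction `v` (slopes are
measured with respect to the lattice length). -/
def HasSlope (S : Set (ℝ × ℝ)) (f : ℝ × ℝ → ℝ) (P : ℝ × ℝ) (v : ℤ × ℤ) (s : ℤ) : Prop :=
  ∃ ε > (0 : ℝ), ∀ t : ℝ, 0 ≤ t → t < ε → P + t • vr v ∈ S →
    f (P + t • vr v) = f P + (s : ℝ) * t

/-- A rational function on (the tropical curve) `S ⊆ ℝ²`: a continuous function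
whose restriction to every edge is piecewise linear with integer slopes,
i.e. which has an integer outgoing slope at every point of `S` in every
outgoing direction. -/
structure IsRationalFn (S : Set (ℝ × ℝ)) (f : ℝ × ℝ → ℝ) : Prop where
  cont : ContinuousOn f S
  slope_int : ∀ P ∈ S, ∀ v ∈ localDirs S P, ∃ s : ℤ, HasSlope S f P v s

/-- The outgoing slope of `f` at `P` in the direction `v` (defaulting to `0`
when no integer slope exists). -/
noncomputable def slope (S : Set (ℝ × ℝ)) (f : ℝ × ℝ → ℝ) (P : ℝ × ℝ) (v : ℤ × ℤ) : ℤ :=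
  open scoped Classical in
  if h : ∃ s : ℤ, HasSlope S f P v s then h.choose else 0

/-- The order `ord_P f`: the sum of the outgoing slopes of `f` over all segments
of `S` emanating from `P`.  Points with `ord_P f > 0` are the zeros of `f`,
points with `ord_P f < 0` its poles. -/
noncomputable def ord (S : Set (ℝ × ℝ)) (f : ℝ × ℝ → ℝ) (P : ℝ × ℝ) : ℤ :=
  ∑ᶠ v ∈ localDirs S P, slope S f P v

/-- Divisors: formal `ℤ`-linear combinations of finitely many points of `ℝ²`. -/
abbrev Div := (ℝ × ℝ) →₀ ℤ

/-- The degree of a divisor: the sum of its coefficients. -/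
def deg (D : Div) : ℤ := D.sum fun _ n => n

/-- A divisor is effective (`D > 0`) when all its coefficients are nonnegative. -/
def Eff (D : Div) : Prop := ∀ P, 0 ≤ D P

/-- `R(D)`: the set of rational functions `f` on `S` with `(f) + D` effective. -/
def RSet (S : Set (ℝ × ℝ)) (D : Div) : Set ((ℝ × ℝ) → ℝ) :=
  {f | IsRationalFn S f ∧ ∀ P ∈ S, 0 ≤ ord S f P + D P}

/-- A divisor is principal when it is the divisor `(f) = Σ_P (ord_P f)·P` of a
rational function `f` on `S`. -/
def IsPrincipal (S : Set (ℝ × ℝ)) (D : Div) : Prop :=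
  ∃ f : (ℝ × ℝ) → ℝ, IsRationalFn S f ∧ ∀ P, D P = ord S f P

/-- Two divisors are (linearly) equivalent, `D ∼ D′`, when `D′ = D + (f)` for
some rational function `f` on `S`. -/
def LinEquiv (S : Set (ℝ × ℝ)) (D D' : Div) : Prop :=
  ∃ f : (ℝ × ℝ) → ℝ, IsRationalFn S f ∧ ∀ P, D' P = D P + ord S f P

end TropicalHyperelliptic

/-! ## The cycles `α_i` and the set `𝔇̃_g^+(Γ)` -/

namespace TropicalHyperelliptic

/-- The basis cycle `α_i` (`1 ≤ i ≤ g`) of the fundamental group `π₁(Γ)`: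
the cycle of `Γ` through the vertices `V_{i−1}`, `V_i` and their conjugates
`V_{i−1}′`, `V_i′`, i.e. the part of `Γ` in the vertical strip
`x(V_i) ≤ X ≤ x(V_{i−1})`. -/
def alphaCycle (g : ℕ) (c : ℤ → ℝ) (i : ℕ) : Set (ℝ × ℝ) :=
  {P ∈ Gam g c | (V g c i).1 ≤ P.1 ∧ P.1 ≤ (V g c (i - 1)).1}

/-- The overlap `α_{k,k+1} = (α_k ∩ α_{k+1}) ∖ {endpoints}` (`1 ≤ k ≤ g − 1`):
the open vertical edge of `Γ` joining `V_k` to `V_k′`.  (For non-adjacent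
indices the overlaps `α_i ∩ α_j` are empty.) -/
def alphaOpen (g : ℕ) (c : ℤ → ℝ) (k : ℕ) : Set (ℝ × ℝ) :=
  {P ∈ Gam g c | P.1 = (V g c k).1 ∧ P ≠ V g c k ∧ P ≠ conj c (V g c k)}

/-- The subset `𝔇̃_g^+(Γ)` of `𝔇_g^+(Γ)`: effective divisors
`P_1 + ⋯ + P_g` with `P_i ∈ α_i` for all `i`, such that each overlap `α_{ij}`
contains at most one of the points. -/
def Dtilde (g : ℕ) (c : ℤ → ℝ) : Set Div :=
  {D | ∃ Pt : Fin g → ℝ × ℝ,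
    (∀ i : Fin g, Pt i ∈ alphaCycle g c (i + 1)) ∧
    (∀ k : ℕ, 1 ≤ k → k ≤ g - 1 →
      ∀ i j : Fin g, Pt i ∈ alphaOpen g c k → Pt j ∈ alphaOpen g c k → i = j) ∧
    D = ∑ i : Fin g, Finsupp.single (Pt i) (1 : ℤ)}

/-- For even `g`, the base divisor `D* = (g/2)(V_0 + V_0′)`. -/
noncomputable def DstarEven (g : ℕ) (c : ℤ → ℝ) : Div :=
  ((g / 2 : ℕ) : ℤ) •
    (Finsupp.single (V g c 0) (1 : ℤ) + Finsupp.single (conj c (V g c 0)) (1 : ℤ))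

/-- For odd `g`, the base divisor `D* = ((g−1)/2)(V_0 + V_0′) + V_0`. -/
noncomputable def DstarOdd (g : ℕ) (c : ℤ → ℝ) : Div :=
  (((g - 1) / 2 : ℕ) : ℤ) •
    (Finsupp.single (V g c 0) (1 : ℤ) + Finsupp.single (conj c (V g c 0)) (1 : ℤ))
  + Finsupp.single (V g c 0) (1 : ℤ)

end TropicalHyperelliptic

open TropicalHyperelliptic
namespace TropicalHyperelliptic

/-- the breakpoint `c_k - c_{k+1}` -/
noncomputable def bk (c : ℤ → ℝ) (k : ℕ) : ℝ := c (k : ℤ) - c ((k : ℤ) + 1)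

/-- being a breakpoint -/
def Brk (g : ℕ) (c : ℤ → ℝ) (X : ℝ) : Prop := ∃ k : ℕ, k ≤ g ∧ X = bk c k

/-- open linearity region with slope `k` -/
def Reg (g : ℕ) (c : ℤ → ℝ) (k : ℕ) (X : ℝ) : Prop :=
  (∀ j : ℕ, j + 1 = k → bk c j < X) ∧ (k ≤ g → X < bk c k)

lemma bk_succ (g : ℕ) (c : ℤ → ℝ) (hc : Hyp g c) (hg2 : 2 ≤ g) (k : ℕ) (hk : k + 1 ≤ g) :
    bk c k < bk c (k + 1) := by
  obtain ⟨h1, h2, h3, h4, h5⟩ := hc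
  unfold bk
  push_cast
  rcases Nat.lt_or_ge (k + 1) g with h | h
  · have := h4 k (by omega)
    have e : (k : ℤ) + 1 + 1 = k + 2 := by ring
    rw [e]; linarith
  · have e : (k : ℤ) = (g : ℤ) - 1 := by omega
    rw [e]
    have e1 : (g : ℤ) - 1 + 1 = g := by ring
    rw [e1, h1, h2]; linarith

lemma bk_lt (g : ℕ) (c : ℤ → ℝ) (hc : Hyp g c) (hg2 : 2 ≤ g) (j k : ℕ) (hjk : j < k)
    (hk : k ≤ g) : bk c j < bk c k := by
  induction k with
  | zero => omega
  | succ k ih =>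
    have h := bk_succ g c hc hg2 k hk
    rcases Nat.lt_or_ge j k with h' | h'
    · exact (ih h' (by omega)).trans h
    · have : j = k := by omega
      subst this; exact h

lemma bk_le (g : ℕ) (c : ℤ → ℝ) (hc : Hyp g c) (hg2 : 2 ≤ g) (j k : ℕ) (hjk : j ≤ k)
    (hk : k ≤ g) : bk c j ≤ bk c k := by
  rcases hjk.lt_or_eq with h | h
  · exact (bk_lt g c hc hg2 j k h hk).le
  · rw [h]

lemma bk_g (g : ℕ) (c : ℤ → ℝ) (hc : Hyp g c) : bk c g = 0 := by
  unfold bk; rw [hc.1, hc.2.1]; ring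

lemma Ptilde_eq (g : ℕ) (c : ℤ → ℝ) (hc : Hyp g c) (hg2 : 2 ≤ g) (k : ℕ) (hk : k ≤ g + 1) (X : ℝ)
    (h1 : ∀ j : ℕ, j + 1 = k → bk c j ≤ X) (h2 : k ≤ g → X ≤ bk c k) :
    Ptilde g c X = c k + k * X := by
  have up : ∀ n : ℕ, k + n ≤ g + 1 → c ((k + n : ℕ) : ℤ) + ((k + n : ℕ) : ℝ) * X ≤ c k + k * X := by
    intro n
    induction n with
    | zero => intro _; simp
    | succ n ih =>
      intro hn
      have := ih (by omega)
      have h := bk_le g c hc hg2 k (k + n) (by omega) (by omega)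
      have h' := h2 (by omega)
      have h3 : X ≤ bk c (k + n) := h'.trans h
      unfold bk at h3
      push_cast at *
      rw [← add_assoc]
      nlinarith
  have down : ∀ n j : ℕ, j + n = k → c (j : ℤ) + (j : ℝ) * X ≤ c k + k * X := by
    intro n
    induction n with
    | zero => intro j hj; simp at hj; subst hj; exact le_refl _
    | succ n ih =>
      intro j hj
      have := ih (j + 1) (by omega)
      have h := bk_le g c hc hg2 j (k - 1) (by omega) (by omega)
      have h' := h1 (k - 1) (by omega)
      have h3 := h.trans h'
      unfold bk at h3
      push_cast at *
      nlinarith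
  unfold Ptilde
  apply le_antisymm
  · apply Finset.sup'_le
    intro j hj
    rw [Finset.mem_range] at hj
    rcases le_total j k with h | h
    · exact down (k - j) j (by omega)
    · have := up (j - k) (by omega)
      rwa [Nat.add_sub_cancel' h] at this
  · exact Finset.le_sup' (fun i : ℕ => c (i : ℤ) + (i : ℝ) * X) (Finset.mem_range.mpr (by omega))

lemma Ptilde_ge (g : ℕ) (c : ℤ → ℝ) (hc : Hyp g c) (X : ℝ) : c (-1) < 2 * Ptilde g c X := by
  have : c 0 ≤ Ptilde g c X := by
    have := Finset.le_sup' (s := Finset.range (g + 2)) (fun i : ℕ => c (i : ℤ) + (i : ℝ) * X)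
      (b := 0) (Finset.mem_range.mpr (by omega))
    unfold Ptilde; simpa only [Nat.cast_zero, zero_mul, add_zero] using this
  linarith [hc.2.2.1]

lemma Reg_eq (g : ℕ) (c : ℤ → ℝ) (hc : Hyp g c) (hg2 : 2 ≤ g) (k : ℕ) (hk : k ≤ g + 1) (X : ℝ)
    (h : Reg g c k X) : Ptilde g c X = c k + k * X :=
  Ptilde_eq g c hc hg2 k hk X (fun j hj => (h.1 j hj).le) (fun hk => (h.2 hk).le)

lemma Reg_not_brk (g : ℕ) (c : ℤ → ℝ) (hc : Hyp g c) (hg2 : 2 ≤ g) (k : ℕ) (X : ℝ)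
    (hk : k ≤ g + 1) (h : Reg g c k X) : ¬ Brk g c X := by
  rintro ⟨j, hj, rfl⟩
  rcases Nat.lt_or_ge j k with h' | h'
  · have h1 := h.1 (k - 1) (by omega)
    have := bk_le g c hc hg2 j (k - 1) (by omega) (by omega)
    linarith
  · have h1 := h.2 (by omega)
    have := bk_le g c hc hg2 k j h' hj
    linarith

lemma locate (g : ℕ) (c : ℤ → ℝ) (X : ℝ) :
    (∃ k : ℕ, k ≤ g ∧ X = bk c k) ∨ (∃ k : ℕ, k ≤ g + 1 ∧ Reg g c k X) := by
  classical
  by_cases h : ∃ k : ℕ, k ≤ g ∧ X ≤ bk c k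
  · obtain ⟨h1, h2⟩ := Nat.find_spec h
    rcases h2.lt_or_eq with h3 | h3
    · right
      refine ⟨Nat.find h, by omega, ?_, fun _ => h3⟩
      intro j hj
      have := Nat.find_min h (m := j) (by omega)
      by_contra hh
      exact this ⟨by omega, not_lt.mp hh⟩
    · left; exact ⟨_, h1, h3⟩
  · right
    push Not at h
    exact ⟨g + 1, le_refl _, fun j hj => h j (by omega), fun h => by omega⟩

lemma Reg_right (g : ℕ) (c : ℤ → ℝ) (k : ℕ) (X : ℝ)
    (h1 : ∀ j : ℕ, j + 1 = k → bk c j ≤ X) (h2 : k ≤ g → X < bk c k) :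
    ∃ δ > (0 : ℝ), ∀ s, 0 < s → s < δ → Reg g c k (X + s) := by
  by_cases hk : k ≤ g
  · refine ⟨bk c k - X, by linarith [h2 hk], fun s hs hs' => ⟨fun j hj => ?_, fun _ => by linarith⟩⟩
    linarith [h1 j hj]
  · exact ⟨1, one_pos, fun s hs hs' => ⟨fun j hj => by linarith [h1 j hj], fun h => absurd h hk⟩⟩

lemma Reg_left (g : ℕ) (c : ℤ → ℝ) (k : ℕ) (X : ℝ)
    (h1 : ∀ j : ℕ, j + 1 = k → bk c j < X) (h2 : k ≤ g → X ≤ bk c k) :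
    ∃ δ > (0 : ℝ), ∀ s, 0 < s → s < δ → Reg g c k (X - s) := by
  rcases Nat.eq_zero_or_pos k with hk | hk
  · exact ⟨1, one_pos, fun s hs hs' => ⟨fun j hj => by omega, fun h => by linarith [h2 h]⟩⟩
  · have := h1 (k - 1) (by omega)
    refine ⟨X - bk c (k - 1), by linarith, fun s hs hs' => ⟨fun j hj => ?_, fun h => by linarith [h2 h]⟩⟩
    have e : j = k - 1 := by omega
    subst e; linarith

/-- local description of `Ptilde` in the direction `σ`, with slope `n`. -/
def Loc (g : ℕ) (c : ℤ → ℝ) (X : ℝ) (σ n : ℤ) : Prop :=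
  ∃ δ > (0 : ℝ), ∀ s, 0 < s → s < δ →
    Ptilde g c (X + σ * s) = Ptilde g c X + σ * n * s ∧ ¬ Brk g c (X + σ * s)

lemma Loc_right (g : ℕ) (c : ℤ → ℝ) (hc : Hyp g c) (hg2 : 2 ≤ g) (k : ℕ) (hk : k ≤ g + 1) (X : ℝ)
    (h1 : ∀ j : ℕ, j + 1 = k → bk c j ≤ X) (h2 : k ≤ g → X < bk c k) : Loc g c X 1 k := by
  obtain ⟨δ, hδ, h⟩ := Reg_right g c k X h1 h2
  refine ⟨δ, hδ, fun s hs hs' => ?_⟩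
  have := h s hs hs'
  push_cast
  rw [one_mul]
  refine ⟨?_, Reg_not_brk g c hc hg2 k _ hk this⟩
  rw [Reg_eq g c hc hg2 k hk _ this, Ptilde_eq g c hc hg2 k hk X h1 (fun h => (h2 h).le)]
  ring

lemma Loc_left (g : ℕ) (c : ℤ → ℝ) (hc : Hyp g c) (hg2 : 2 ≤ g) (k : ℕ) (hk : k ≤ g + 1) (X : ℝ)
    (h1 : ∀ j : ℕ, j + 1 = k → bk c j < X) (h2 : k ≤ g → X ≤ bk c k) : Loc g c X (-1) k := by
  obtain ⟨δ, hδ, h⟩ := Reg_left g c k X h1 h2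
  refine ⟨δ, hδ, fun s hs hs' => ?_⟩
  have := h s hs hs'
  have e : X + ((-1 : ℤ) : ℝ) * s = X - s := by push_cast; ring
  rw [e]
  refine ⟨?_, Reg_not_brk g c hc hg2 k _ hk this⟩
  rw [Reg_eq g c hc hg2 k hk _ this, Ptilde_eq g c hc hg2 k hk X (fun j h => (h1 j h).le) h2]
  push_cast
  ring

lemma Loc_brk (g : ℕ) (c : ℤ → ℝ) (hc : Hyp g c) (hg2 : 2 ≤ g) (k : ℕ) (hk : k ≤ g) :
    Loc g c (bk c k) 1 ((k : ℤ) + 1) ∧ Loc g c (bk c k) (-1) k := by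
  constructor
  · have := Loc_right g c hc hg2 (k + 1) (by omega) (bk c k)
      (fun j hj => by have : j = k := by omega
                      subst this; exact le_refl _) (fun h => bk_succ g c hc hg2 k h)
    exact_mod_cast this
  · exact Loc_left g c hc hg2 k (by omega) (bk c k)
      (fun j hj => bk_lt g c hc hg2 j k (by omega) hk) (fun _ => le_refl _)

lemma Loc_reg (g : ℕ) (c : ℤ → ℝ) (hc : Hyp g c) (hg2 : 2 ≤ g) (k : ℕ) (hk : k ≤ g + 1) (X : ℝ)
    (h : Reg g c k X) : Loc g c X 1 k ∧ Loc g c X (-1) k :=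
  ⟨Loc_right g c hc hg2 k hk X (fun j hj => (h.1 j hj).le) h.2,
   Loc_left g c hc hg2 k hk X h.1 (fun hk => (h.2 hk).le)⟩

lemma Ptilde_cont (g : ℕ) (c : ℤ → ℝ) : Continuous (Ptilde g c) := by
  unfold Ptilde
  apply Continuous.finset_sup'_apply
  intro i _
  fun_prop

lemma Reg_open (g : ℕ) (c : ℤ → ℝ) (k : ℕ) (X : ℝ) (h : Reg g c k X) :
    ∀ᶠ Z in nhds X, Reg g c k Z := by
  have a : ∀ᶠ Z in nhds X, (∀ j : ℕ, j + 1 = k → bk c j < Z) := by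
    rcases Nat.eq_zero_or_pos k with hk | hk
    · exact Filter.Eventually.of_forall fun Z j hj => by omega
    · filter_upwards [lt_mem_nhds (h.1 (k - 1) (by omega))] with Z hZ j hj
      have e : j = k - 1 := by omega
      subst e; exact hZ
  have b : ∀ᶠ Z in nhds X, (k ≤ g → Z < bk c k) := by
    by_cases hk : k ≤ g
    · filter_upwards [gt_mem_nhds (h.2 hk)] with Z hZ _
      exact hZ
    · exact Filter.Eventually.of_forall fun Z j => absurd j hk
  filter_upwards [a, b] with Z h1 h2
  exact ⟨h1, h2⟩

/-- two-sided linear behaviour with mismatched slopes contradicts differentiability -/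
lemma not_diff (F : ℝ × ℝ → ℝ) (P v : ℝ × ℝ) (a b δ : ℝ) (hδ : 0 < δ)
    (h1 : ∀ t, 0 < t → t < δ → F (P + t • v) = F P + a * t)
    (h2 : ∀ t, 0 < t → t < δ → F (P - t • v) = F P - b * t) (hab : a ≠ b) :
    ¬ DifferentiableAt ℝ F P := by
  intro hF
  have hd : HasDerivAt (fun t : ℝ => F (P + t • v)) (fderiv ℝ F P v) 0 := by
    have h0 : HasFDerivAt F (fderiv ℝ F P) (P + (0 : ℝ) • v) := by simpa using hF.hasFDerivAt
    have hl : HasDerivAt (fun t : ℝ => P + t • v) v 0 := by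
      simpa using ((hasDerivAt_id (0 : ℝ)).smul_const v).const_add P
    exact h0.comp_hasDerivAt (0 : ℝ) hl
  have ra : HasDerivWithinAt (fun t : ℝ => F (P + t • v)) a (Set.Ici 0) 0 := by
    have hl : HasDerivWithinAt (fun t : ℝ => F P + a * t) a (Set.Ici 0) 0 := by
      simpa using (((hasDerivAt_id (0 : ℝ)).const_mul a).const_add (F P)).hasDerivWithinAt
    refine hl.congr_of_eventuallyEq ?_ (by simp)
    filter_upwards [self_mem_nhdsWithin, mem_nhdsWithin_of_mem_nhds (gt_mem_nhds hδ)] with t ht ht'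
    rcases (Set.mem_Ici.mp ht).lt_or_eq with h | h
    · exact h1 t h ht'
    · simp [← h]
  have rb : HasDerivWithinAt (fun t : ℝ => F (P + t • v)) b (Set.Iic 0) 0 := by
    have hl : HasDerivWithinAt (fun t : ℝ => F P + b * t) b (Set.Iic 0) 0 := by
      simpa using (((hasDerivAt_id (0 : ℝ)).const_mul b).const_add (F P)).hasDerivWithinAt
    refine hl.congr_of_eventuallyEq ?_ (by simp)
    filter_upwards [self_mem_nhdsWithin,
      mem_nhdsWithin_of_mem_nhds (lt_mem_nhds (neg_lt_zero.mpr hδ))] with t ht ht'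
    rcases (Set.mem_Iic.mp ht).lt_or_eq with h | h
    · have := h2 (-t) (by linarith) (by linarith)
      simp only [neg_smul, sub_neg_eq_add] at this
      rw [this]; ring
    · simp [h]
  have e1 := (uniqueDiffOn_Ici (0 : ℝ) 0 (by simp)).eq_deriv _ ra hd.hasDerivWithinAt
  have e2 := (uniqueDiffOn_Iic (0 : ℝ) 0 (by simp)).eq_deriv _ rb hd.hasDerivWithinAt
  exact hab (e1.trans e2.symm)

lemma mem_curveBar (g : ℕ) (c : ℤ → ℝ) (hc : Hyp g c) (hg2 : 2 ≤ g) (P : ℝ × ℝ) :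
    P ∈ curveBar g c ↔ (P.2 = Ptilde g c P.1 ∨ P.2 = c (-1) - Ptilde g c P.1 ∨
      (c (-1) - Ptilde g c P.1 ≤ P.2 ∧ P.2 ≤ Ptilde g c P.1 ∧ Brk g c P.1)) := by
  obtain ⟨X, Y⟩ := P
  have hp := Ptilde_ge g c hc X
  have hcont := Ptilde_cont g c
  simp only [curveBar, Set.mem_ofPred_eq]
  have up : Y = Ptilde g c X → ¬ DifferentiableAt ℝ (Ftilde g c) (X, Y) := by
    intro h
    refine not_diff _ _ (0, 1) 2 1 (2 * Ptilde g c X - c (-1)) (by linarith) ?_ ?_ (by norm_num)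
    · intro t ht ht'
      simp only [Ftilde, Prod.smul_mk, Prod.mk_add_mk, smul_eq_mul, mul_zero, mul_one, add_zero]
      rw [max_eq_left, max_eq_left]
      · ring
      · apply max_le <;> linarith
      · apply max_le <;> linarith
    · intro t ht ht'
      simp only [Ftilde, Prod.smul_mk, Prod.mk_sub_mk, smul_eq_mul, mul_zero, mul_one, sub_zero]
      rw [max_eq_right (a := 2 * (Y - t)), max_eq_left (b := c (-1)), max_eq_left (a := 2 * Y)]
      · linarith
      · apply max_le <;> linarith
      · linarith
      · exact le_trans (by linarith) (le_max_left _ _)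
  have down : Y = c (-1) - Ptilde g c X → ¬ DifferentiableAt ℝ (Ftilde g c) (X, Y) := by
    intro h
    refine not_diff _ _ (0, 1) 1 0 (2 * Ptilde g c X - c (-1)) (by linarith) ?_ ?_ (by norm_num)
    · intro t ht ht'
      simp only [Ftilde, Prod.smul_mk, Prod.mk_add_mk, smul_eq_mul, mul_zero, mul_one, add_zero]
      rw [max_eq_left (b := c (-1)), max_eq_right, max_eq_right (b := c (-1)), max_eq_right]
      all_goals first | linarith | skip
    · intro t ht ht'
      simp only [Ftilde, Prod.smul_mk, Prod.mk_sub_mk, smul_eq_mul, mul_zero, mul_one, sub_zero]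
      rw [max_eq_right (b := c (-1)), max_eq_right, max_eq_right (b := c (-1)), max_eq_right]
      all_goals first | linarith | skip
  constructor
  · intro hnd
    by_contra hcon
    push Not at hcon
    obtain ⟨n1, n2, n3⟩ := hcon
    apply hnd
    have c1 : Continuous fun Q : ℝ × ℝ => Q.2 - Ptilde g c Q.1 := by fun_prop
    have c2 : Continuous fun Q : ℝ × ℝ => Q.2 + Ptilde g c Q.1 := by fun_prop
    rcases lt_or_gt_of_ne n1 with h | h
    · rcases lt_or_gt_of_ne n2 with h' | h'
      · have e2 : ∀ᶠ Q in nhds (X, Y), Q.2 + Ptilde g c Q.1 < c (-1) :=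
          c2.continuousAt.eventually_lt continuousAt_const (by simp only; linarith)
        have : Ftilde g c =ᶠ[nhds (X, Y)] fun _ => c (-1) := by
          filter_upwards [e2] with Q h2
          have := Ptilde_ge g c hc Q.1
          simp only [Ftilde]
          rw [max_eq_right (b := c (-1)), max_eq_right] <;> linarith
        exact (differentiableAt_const _).congr_of_eventuallyEq this
      · have nb := n3 h'.le h.le
        rcases locate g c X with hb | ⟨k, hk, hr⟩
        · exact absurd hb nb
        have e1 : ∀ᶠ Q in nhds (X, Y), Q.2 - Ptilde g c Q.1 < 0 :=
          c1.continuousAt.eventually_lt continuousAt_const (by simp only; linarith)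
        have e2 : ∀ᶠ Q in nhds (X, Y), c (-1) < Q.2 + Ptilde g c Q.1 :=
          continuousAt_const.eventually_lt c2.continuousAt (by simp only; linarith)
        have e3 : ∀ᶠ Q in nhds (X, Y), Reg g c k Q.1 :=
          (continuous_fst.tendsto (X, Y)).eventually (Reg_open g c k X hr)
        have : Ftilde g c =ᶠ[nhds (X, Y)] fun Q => Q.2 + (c k + k * Q.1) := by
          filter_upwards [e1, e2, e3] with Q h1 h2 h3
          simp only [Ftilde]
          rw [max_eq_left (b := c (-1)), max_eq_right, Reg_eq g c hc hg2 k hk _ h3] <;> linarith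
        refine DifferentiableAt.congr_of_eventuallyEq ?_ this
        fun_prop
    · have e1 : ∀ᶠ Q in nhds (X, Y), 0 < Q.2 - Ptilde g c Q.1 :=
        continuousAt_const.eventually_lt c1.continuousAt (by simp only; linarith)
      have : Ftilde g c =ᶠ[nhds (X, Y)] fun Q => 2 * Q.2 := by
        filter_upwards [e1] with Q h1
        have := Ptilde_ge g c hc Q.1
        simp only [Ftilde]
        rw [max_eq_left]
        apply max_le <;> linarith
      refine DifferentiableAt.congr_of_eventuallyEq ?_ this
      fun_prop
  · rintro (h | h | ⟨h1, h2, ⟨k, hk, hX⟩⟩)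
    · exact up h
    · exact down h
    · rcases h1.lt_or_eq with h1 | h1
      swap
      · exact down h1.symm
      rcases h2.lt_or_eq with h2 | h2
      swap
      · exact up h2
      obtain ⟨⟨d1, hd1, l1⟩, ⟨d2, hd2, l2⟩⟩ := Loc_brk g c hc hg2 k hk
      rw [← hX] at l1 l2
      have c1 : Continuous fun Q : ℝ => Y - Ptilde g c Q := by fun_prop
      have c2 : Continuous fun Q : ℝ => Y + Ptilde g c Q := by fun_prop
      have e1 : ∀ᶠ Q in nhds X, Y - Ptilde g c Q < 0 :=
          c1.continuousAt.eventually_lt continuousAt_const (by linarith)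
      have e2 : ∀ᶠ Q in nhds X, c (-1) < Y + Ptilde g c Q :=
          continuousAt_const.eventually_lt c2.continuousAt (by linarith)
      obtain ⟨d3, hd3, l3⟩ := Metric.eventually_nhds_iff.mp (e1.and e2)
      have val : ∀ Q, dist Q X < d3 → Ftilde g c (Q, Y) = Y + Ptilde g c Q := by
        intro Q hQ
        have := l3 hQ
        simp only [Ftilde]
        rw [max_eq_left (b := c (-1)), max_eq_right] <;> linarith
      have vX := val X (by simpa using hd3)
      refine not_diff _ _ (1, 0) (k + 1) k (min d1 (min d2 d3))
        (lt_min hd1 (lt_min hd2 hd3)) ?_ ?_ (by simp)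
      · intro t ht ht'
        simp only [lt_min_iff] at ht'
        simp only [Prod.smul_mk, Prod.mk_add_mk, smul_eq_mul, mul_zero, mul_one, add_zero]
        rw [vX, val _ (by simp [abs_of_pos ht, ht'])]
        have := (l1 t ht ht'.1).1
        push_cast at this
        rw [one_mul, one_mul] at this
        rw [this]; ring
      · intro t ht ht'
        simp only [lt_min_iff] at ht'
        simp only [Prod.smul_mk, Prod.mk_sub_mk, smul_eq_mul, mul_zero, mul_one, sub_zero]
        rw [vX, val _ (by simp [Real.dist_eq, abs_of_pos ht, ht'])]
        have := (l2 t ht ht'.2.1).1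
        push_cast at this
        rw [show X + -1 * t = X - t by ring] at this
        rw [this]; ring

lemma mem_Gam (g : ℕ) (c : ℤ → ℝ) (hc : Hyp g c) (hg2 : 2 ≤ g) (P : ℝ × ℝ) :
    P ∈ Gam g c ↔ (P.2 = Ptilde g c P.1 ∨ P.2 = c (-1) - Ptilde g c P.1 ∨
      (c (-1) - Ptilde g c P.1 ≤ P.2 ∧ P.2 ≤ Ptilde g c P.1 ∧ Brk g c P.1)) ∧
      bk c 0 ≤ P.1 ∧ P.1 ≤ 0 := by
  unfold Gam
  rw [Set.mem_ofPred_eq, mem_curveBar g c hc hg2]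
  simp [bk]

end TropicalHyperelliptic

namespace TropicalHyperelliptic

lemma lin3 (α β α' β' t : ℝ) (ht : 0 < t)
    (h : ∀ s, 0 < s → s ≤ t → α + β * s = 0 ∨ α' + β' * s = 0) :
    (α = 0 ∧ β = 0) ∨ (α' = 0 ∧ β' = 0) := by
  have key : ∀ x y s r : ℝ, s < r → x + y * s = 0 → x + y * r = 0 → x = 0 ∧ y = 0 := by
    intro x y s r hsr h1 h2
    have : y * (r - s) = 0 := by linarith
    rcases mul_eq_zero.mp this with h | h
    · subst h; simp at h1; exact ⟨h1, rfl⟩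
    · linarith
  have a1 : t / 3 < t / 2 := by linarith
  have a2 : t / 2 < t := by linarith
  have a3 : t / 3 < t := by linarith
  rcases h t ht le_rfl with h1 | h1 <;> rcases h (t / 2) (by linarith) a2.le with h2 | h2 <;>
    rcases h (t / 3) (by linarith) a3.le with h3 | h3
  · exact Or.inl (key _ _ _ _ a2 h2 h1)
  · exact Or.inl (key _ _ _ _ a2 h2 h1)
  · exact Or.inl (key _ _ _ _ a3 h3 h1)
  · exact Or.inr (key _ _ _ _ a1 h3 h2)
  · exact Or.inl (key _ _ _ _ a1 h3 h2)
  · exact Or.inr (key _ _ _ _ a3 h3 h1)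
  · exact Or.inr (key _ _ _ _ a2 h2 h1)
  · exact Or.inr (key _ _ _ _ a2 h2 h1)

lemma small_le (x y ε : ℝ) (k : ℝ) (hε : 0 < ε) (h : ∀ t, 0 < t → t < ε → x ≤ y + t * k) :
    x ≤ y := by
  by_contra hxy
  push Not at hxy
  have hk : 0 < |k| + 1 := by positivity
  set t := min (ε / 2) ((x - y) / (2 * (|k| + 1))) with ht
  have t0 : 0 < t := lt_min (by linarith) (by apply div_pos <;> linarith)
  have t1 : t < ε := lt_of_le_of_lt (min_le_left _ _) (by linarith)
  have t2 : t ≤ (x - y) / (2 * (|k| + 1)) := min_le_right _ _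
  rw [le_div_iff₀ (by linarith)] at t2
  have := h t t0 t1
  have h3 := le_abs_self k
  nlinarith

lemma smul_vr (X Y t : ℝ) (v : ℤ × ℤ) :
    ((X, Y) : ℝ × ℝ) + t • vr v = (X + t * v.1, Y + t * v.2) := by
  simp [vr]

lemma dirs_strip (g : ℕ) (c : ℤ → ℝ) (hc : Hyp g c) (hg2 : 2 ≤ g) (X Y : ℝ) (v : ℤ × ℤ)
    (hv : v ∈ localDirs (Gam g c) (X, Y)) : bk c 0 ≤ X ∧ X ≤ 0 := by
  obtain ⟨-, ε, hε, h⟩ := hv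
  have h' := fun t h1 h2 => (mem_Gam g c hc hg2 _).mp (h t h1 h2)
  simp only [smul_vr] at h'
  constructor
  · exact small_le _ _ ε v.1 hε fun t h1 h2 => (h' t h1 h2).2.1
  · exact small_le _ _ ε (-v.1) hε fun t h1 h2 => by linarith [(h' t h1 h2).2.2]

lemma dirs_side (g : ℕ) (c : ℤ → ℝ) (hc : Hyp g c) (hg2 : 2 ≤ g) (X Y : ℝ) (v : ℤ × ℤ)
    (hX : bk c 0 ≤ X ∧ X ≤ 0) (σ n : ℤ) (hσ : σ = 1 ∨ σ = -1) (hv : 0 < σ * v.1)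
    (hl : Loc g c X σ n) :
    v ∈ localDirs (Gam g c) (X, Y) ↔ v.1 = σ ∧ (σ = 1 ∧ X < 0 ∨ σ = -1 ∧ bk c 0 < X) ∧
      ((Y = Ptilde g c X ∧ v.2 = σ * n) ∨ (Y = c (-1) - Ptilde g c X ∧ v.2 = - (σ * n))) := by
  obtain ⟨δ, hδ, hl⟩ := hl
  obtain ⟨v1, v2⟩ := v
  simp only at hv ⊢
  have hσ2 : σ * σ = 1 := by rcases hσ with h | h <;> simp [h]
  constructor
  · rintro ⟨hco, ε, hε, h⟩
    simp only at hco
    have h' := fun t h1 h2 => (mem_Gam g c hc hg2 _).mp (h t h1 h2)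
    simp only [smul_vr] at h'
    set w := σ * v1 with hw
    have hv1 : v1 = σ * w := by rw [hw, ← mul_assoc, hσ2, one_mul]
    have hwR : (0 : ℝ) < w := by exact_mod_cast hv
    set τ := min (ε / 2) (δ / (2 * w)) with hτ
    have τ0 : 0 < τ := lt_min (by linarith) (by positivity)
    have τ1 : τ < ε := lt_of_le_of_lt (min_le_left _ _) (by linarith)
    have τ2 : τ ≤ δ / (2 * w) := min_le_right _ _
    rw [le_div_iff₀ (by linarith)] at τ2
    have key := lin3 (Y - Ptilde g c X) (v2 - σ * n * w) (Y - (c (-1) - Ptilde g c X))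
      (v2 + σ * n * w) τ τ0 (by
        intro s hs hs'
        have h1 := (h' s hs (by linarith)).1
        have hsw : s * w < δ := by nlinarith
        have h2 := hl (s * w) (by positivity) hsw
        have e : X + s * (v1 : ℝ) = X + σ * (s * w) := by rw [hv1]; push_cast; ring
        rw [e, h2.1] at h1
        rcases h1 with h1 | h1 | h1
        · left; linarith
        · right; linarith
        · exact absurd h1.2.2 h2.2)
    have hdiv : v2 = σ * n * w ∨ v2 = -(σ * n * w) := by
      rcases key with ⟨-, h⟩ | ⟨-, h⟩
      · left; have : (v2 : ℝ) = σ * n * w := by linarith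
        exact_mod_cast this
      · right; have : (v2 : ℝ) = -(σ * n * w) := by linarith
        exact_mod_cast this
    have hw1 : w = 1 := by
      have hd : w ∣ v2 := by
        rcases hdiv with h | h
        · exact ⟨σ * n, by rw [h]; ring⟩
        · exact ⟨-(σ * n), by rw [h]; ring⟩
      have hd1 : w ∣ v1 := ⟨σ, by rw [hv1]; ring⟩
      have := hco.isUnit_of_dvd' hd1 hd
      rcases Int.isUnit_iff.mp this with h | h <;> omega
    rw [hw1] at hv1 hdiv key
    refine ⟨by simpa using hv1, ?_, ?_⟩
    · have h3 := h' τ τ0 τ1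
      have e : (v1 : ℝ) = σ := by rw [hv1]; simp
      rw [e] at h3
      rcases hσ with h | h
      · left; rw [h] at h3; push_cast at h3; exact ⟨h, by linarith⟩
      · right; rw [h] at h3; push_cast at h3; exact ⟨h, by linarith⟩
    · push_cast at key
      rcases key with ⟨h1, h2⟩ | ⟨h1, h2⟩
      · left
        refine ⟨by linarith, ?_⟩
        have : (v2 : ℝ) = σ * n := by linarith
        exact_mod_cast this
      · right
        refine ⟨by linarith, ?_⟩
        have : (v2 : ℝ) = -(σ * n) := by linarith
        exact_mod_cast this
  · rintro ⟨h1, hroom, h2⟩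
    subst h1
    refine ⟨?_, ?_⟩
    · simp only
      rcases hσ with h | h <;> rw [h]
      · exact isCoprime_one_left
      · exact isCoprime_one_left.neg_left
    · have hr : ∃ ε > (0 : ℝ), ∀ t, 0 < t → t < ε → bk c 0 ≤ X + t * v1 ∧ X + t * v1 ≤ 0 := by
        rcases hroom with ⟨h, hx⟩ | ⟨h, hx⟩
        · refine ⟨-X, by linarith, fun t ht ht' => ?_⟩
          rw [h]; push_cast; constructor <;> linarith [hX.1]
        · refine ⟨X - bk c 0, by linarith, fun t ht ht' => ?_⟩
          rw [h]; push_cast; constructor <;> linarith [hX.2]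
      obtain ⟨ε, hε, hr⟩ := hr
      refine ⟨min ε δ, lt_min hε hδ, fun t ht ht' => ?_⟩
      simp only [lt_min_iff] at ht'
      rw [smul_vr, mem_Gam g c hc hg2]
      refine ⟨?_, hr t ht ht'.1⟩
      have := (hl t ht ht'.2).1
      simp only
      rw [mul_comm t (v1 : ℝ), this]
      rcases h2 with ⟨h2, h3⟩ | ⟨h2, h3⟩
      · left; rw [h2, h3]; push_cast; ring
      · right; left; rw [h2, h3]; push_cast; ring

lemma dirs_vert (g : ℕ) (c : ℤ → ℝ) (hc : Hyp g c) (hg2 : 2 ≤ g) (X Y : ℝ) (v : ℤ × ℤ)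
    (hX : bk c 0 ≤ X ∧ X ≤ 0) (hv : v.1 = 0) :
    v ∈ localDirs (Gam g c) (X, Y) ↔ Brk g c X ∧
      ((v.2 = 1 ∧ c (-1) - Ptilde g c X ≤ Y ∧ Y < Ptilde g c X) ∨
       (v.2 = -1 ∧ c (-1) - Ptilde g c X < Y ∧ Y ≤ Ptilde g c X)) := by
  obtain ⟨v1, v2⟩ := v
  simp only at hv ⊢
  subst hv
  have hp := Ptilde_ge g c hc X
  constructor
  · rintro ⟨hco, ε, hε, h⟩
    simp only at hco
    have h' := fun t h1 h2 => (mem_Gam g c hc hg2 _).mp (h t h1 h2)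
    simp only [smul_vr, Int.cast_zero, mul_zero, add_zero] at h'
    have hu : v2 = 1 ∨ v2 = -1 := Int.isUnit_iff.mp (isCoprime_zero_left.mp hco)
    have hB : Brk g c X := by
      by_contra hB
      have := lin3 (Y - Ptilde g c X) v2 (Y - (c (-1) - Ptilde g c X)) v2 (ε / 2) (by linarith) (by
        intro s hs hs'
        rcases (h' s hs (by linarith)).1 with h | h | h
        · left; linarith
        · right; linarith
        · exact absurd h.2.2 hB)
      have h0 : (v2 : ℝ) = 0 := by rcases this with h | h <;> exact h.2
      have h0' : v2 = 0 := by exact_mod_cast h0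
      omega
    have hb : ∀ t, 0 < t → t < ε → c (-1) - Ptilde g c X ≤ Y + t * v2 ∧
        Y + t * v2 ≤ Ptilde g c X := by
      intro t ht ht'
      rcases (h' t ht ht').1 with h | h | h
      · constructor <;> linarith
      · constructor <;> linarith
      · exact ⟨h.1, h.2.1⟩
    have h1 := small_le _ _ ε v2 hε fun t h1 h2 => (hb t h1 h2).1
    have h2 := small_le Y (Ptilde g c X) ε (-v2) hε fun t h1 h2 => by linarith [(hb t h1 h2).2]
    have h3 := hb (ε / 2) (by linarith) (by linarith)
    refine ⟨hB, ?_⟩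
    rcases hu with h | h
    · left
      rw [h] at h3
      push_cast at h3
      exact ⟨h, h1, by linarith⟩
    · right
      rw [h] at h3
      push_cast at h3
      exact ⟨h, by linarith, h2⟩
  · rintro ⟨hB, h⟩
    refine ⟨isCoprime_zero_left.mpr (Int.isUnit_iff.mpr ?_), ?_⟩
    · rcases h with h | h
      · exact Or.inl h.1
      · exact Or.inr h.1
    · rcases h with ⟨rfl, h1, h2⟩ | ⟨rfl, h1, h2⟩
      · refine ⟨Ptilde g c X - Y, by linarith, fun t ht ht' => ?_⟩
        rw [smul_vr, mem_Gam g c hc hg2]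
        push_cast
        rw [mul_zero, add_zero]
        exact ⟨Or.inr (Or.inr ⟨by linarith, by linarith, hB⟩), hX⟩
      · refine ⟨Y - (c (-1) - Ptilde g c X), by linarith, fun t ht ht' => ?_⟩
        rw [smul_vr, mem_Gam g c hc hg2]
        push_cast
        rw [mul_zero, add_zero]
        exact ⟨Or.inr (Or.inr ⟨by linarith, by linarith, hB⟩), hX⟩

lemma mem_dirs (g : ℕ) (c : ℤ → ℝ) (hc : Hyp g c) (hg2 : 2 ≤ g) (X Y : ℝ) (v w : ℤ)
    (hX : bk c 0 ≤ X ∧ X ≤ 0) (m n : ℤ) (hr : Loc g c X 1 n) (hl : Loc g c X (-1) m) :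
    (v, w) ∈ localDirs (Gam g c) (X, Y) ↔
      (v = 1 ∧ X < 0 ∧ ((Y = Ptilde g c X ∧ w = n) ∨ (Y = c (-1) - Ptilde g c X ∧ w = -n))) ∨
      (v = -1 ∧ bk c 0 < X ∧
        ((Y = Ptilde g c X ∧ w = -m) ∨ (Y = c (-1) - Ptilde g c X ∧ w = m))) ∨
      (v = 0 ∧ Brk g c X ∧
      ((w = 1 ∧ c (-1) - Ptilde g c X ≤ Y ∧ Y < Ptilde g c X) ∨
       (w = -1 ∧ c (-1) - Ptilde g c X < Y ∧ Y ≤ Ptilde g c X))) := by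
  rcases lt_trichotomy v 0 with h | h | h
  · rw [dirs_side g c hc hg2 X Y (v, w) hX (-1) m (by simp) (by simpa using h) hl]
    have : v ≠ 1 := by omega
    have : v ≠ 0 := by omega
    simp_all
  · rw [dirs_vert g c hc hg2 X Y (v, w) hX h]
    simp_all
  · rw [dirs_side g c hc hg2 X Y (v, w) hX 1 n (by simp) (by simpa using h) hr]
    have : v ≠ -1 := by omega
    have : v ≠ 0 := by omega
    simp_all

lemma hasSlope_lin (S : Set (ℝ × ℝ)) (a : ℝ) (i j : ℤ) (P : ℝ × ℝ) (v : ℤ × ℤ) :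
    HasSlope S (fun p => a + i * p.1 + j * p.2) P v (i * v.1 + j * v.2) := by
  refine ⟨1, one_pos, fun t _ _ _ => ?_⟩
  simp [vr]
  ring

lemma slope_lin (S : Set (ℝ × ℝ)) (a : ℝ) (i j : ℤ) (P : ℝ × ℝ) (v : ℤ × ℤ)
    (hv : v ∈ localDirs S P) :
    slope S (fun p => a + i * p.1 + j * p.2) P v = i * v.1 + j * v.2 := by
  have hs := hasSlope_lin S a i j P v
  have hex : ∃ s : ℤ, HasSlope S (fun p => a + i * p.1 + j * p.2) P v s := ⟨_, hs⟩
  unfold slope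
  rw [dif_pos hex]
  obtain ⟨ε1, h1, k1⟩ := hex.choose_spec
  obtain ⟨ε2, h2, k2⟩ := hs
  obtain ⟨-, ε3, h3, k3⟩ := hv
  set t := min ε1 (min ε2 ε3) / 2 with ht
  have hm : 0 < min ε1 (min ε2 ε3) := lt_min h1 (lt_min h2 h3)
  have htl : t < min ε1 (min ε2 ε3) := by linarith
  have t0 : 0 < t := by linarith
  simp only [lt_min_iff] at htl
  have hin := k3 t t0 htl.2.2
  have e := (k1 t t0.le htl.1 hin).symm.trans (k2 t t0.le htl.2.1 hin)
  have e2 := mul_right_cancel₀ t0.ne' (add_left_cancel e)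
  exact_mod_cast e2

lemma ord_lin (S : Set (ℝ × ℝ)) (a : ℝ) (i j : ℤ) (P : ℝ × ℝ) (T : Finset (ℤ × ℤ))
    (hT : ∀ v w : ℤ, (v, w) ∈ localDirs S P ↔ (v, w) ∈ T) :
    ord S (fun p => a + i * p.1 + j * p.2) P = ∑ v ∈ T, (i * v.1 + j * v.2) := by
  have hT' : localDirs S P = ↑T := by
    ext ⟨v, w⟩; exact hT v w
  unfold ord
  rw [hT', finsum_mem_coe_finset]
  apply Finset.sum_congr rfl
  intro v hv
  exact slope_lin S a i j P v (by rw [hT']; exact hv)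

lemma V_zero (g : ℕ) (c : ℤ → ℝ) (hc : Hyp g c) (hg2 : 2 ≤ g) :
    V g c 0 = (0, Ptilde g c 0) := by
  rw [Ptilde_eq g c hc hg2 g (by omega) 0 (fun j hj => ?_) (fun _ => (bk_g g c hc).ge)]
  · simp [V, hc.1, hc.2.1]
  · rw [← bk_g g c hc]; exact bk_le g c hc hg2 _ _ (by omega) le_rfl

lemma V_g (g : ℕ) (c : ℤ → ℝ) (hc : Hyp g c) (hg2 : 2 ≤ g) :
    V g c g = (bk c 0, Ptilde g c (bk c 0)) := by
  rw [Ptilde_eq g c hc hg2 0 (by omega) _ (fun j hj => by omega) (fun _ => le_rfl)]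
  simp [V, bk]

open scoped Classical in
lemma ord_main (g : ℕ) (c : ℤ → ℝ) (hc : Hyp g c) (hg2 : 2 ≤ g) (a : ℝ) (i j : ℤ) (X Y : ℝ) :
    ord (Gam g c) (fun p => a + i * p.1 + j * p.2) (X, Y) =
      i * ((if X = bk c 0 ∧ Y = Ptilde g c X then 1 else 0) +
        (if X = bk c 0 ∧ Y = c (-1) - Ptilde g c X then 1 else 0)) +
      (-i - j * (g + 1)) * (if X = 0 ∧ Y = Ptilde g c X then 1 else 0) +
      (-i + j * (g + 1)) * (if X = 0 ∧ Y = c (-1) - Ptilde g c X then 1 else 0) := by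
  have hp := Ptilde_ge g c hc X
  have hb0 : bk c 0 < 0 := by
    rw [← bk_g g c hc]; exact bk_lt g c hc hg2 0 g (by omega) le_rfl
  have hud : ¬ (Ptilde g c X = c (-1) - Ptilde g c X) := by intro h; linarith
  have hdu : ¬ (c (-1) - Ptilde g c X = Ptilde g c X) := by intro h; linarith
  have hlt : (c (-1) - Ptilde g c X < Ptilde g c X) := by linarith
  by_cases hX : bk c 0 ≤ X ∧ X ≤ 0
  swap
  · rw [ord_lin _ a i j _ ∅]
    · have h1 : X ≠ bk c 0 := by rintro rfl; exact hX ⟨le_rfl, hb0.le⟩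
      have h2 : X ≠ 0 := by rintro rfl; exact hX ⟨hb0.le, le_rfl⟩
      simp [h1, h2]
    · intro v w
      simp only [Finset.notMem_empty, iff_false]
      exact fun h => hX (dirs_strip g c hc hg2 X Y _ h)
  rcases locate g c X with ⟨k, hk, hXk⟩ | ⟨k, hk, hr⟩
  · obtain ⟨hr, hl⟩ := Loc_brk g c hc hg2 k hk
    rw [← hXk] at hr hl
    have hB : Brk g c X := ⟨k, hk, hXk⟩
    have D := mem_dirs g c hc hg2 X Y
    have D := fun v w => D v w hX _ _ hr hl
    have k0 : X = bk c 0 ↔ k = 0 := by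
      constructor
      · intro h
        by_contra h'
        have := bk_lt g c hc hg2 0 k (by omega) hk
        linarith
      · rintro rfl; exact hXk
    have kg : X = 0 ↔ k = g := by
      rw [← bk_g g c hc]
      constructor
      · intro h
        by_contra h'
        have := bk_lt g c hc hg2 k g (by omega) le_rfl
        linarith
      · rintro rfl; exact hXk
    have k0' : bk c 0 < X ↔ k ≠ 0 := by
      rw [hX.1.lt_iff_ne, ne_comm, ne_eq, k0]
    have kg' : X < 0 ↔ k ≠ g := by
      rw [hX.2.lt_iff_ne, ne_eq, kg]
    simp only [k0, kg, k0', kg', hB, true_and] at D ⊢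
    by_cases hu : Y = Ptilde g c X
    · subst hu
      simp only [hud, hlt, true_and, false_and, lt_irrefl, and_false, or_false, false_or, le_refl,
        and_true, hlt.le] at D ⊢
      by_cases e0 : k = 0
      · have eg : k ≠ g := by omega
        rw [ord_lin _ a i j _ {(1, 1), (0, -1)}]
        · simp [e0]; simp [show ¬ (0 = g) by omega]
        · intro v w; rw [D]; simp [e0]; omega
      · by_cases eg : k = g
        · rw [ord_lin _ a i j _ {(-1, -(k : ℤ)), (0, -1)}]
          · simp [eg, show g ≠ 0 by omega]; ring
          · intro v w; rw [D]; simp [eg, show g ≠ 0 by omega]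
        · rw [ord_lin _ a i j _ {(1, (k : ℤ) + 1), (-1, -(k : ℤ)), (0, -1)}]
          · simp [eg, e0]; ring
          · intro v w; rw [D]; simp [eg, e0]
    · by_cases hd : Y = c (-1) - Ptilde g c X
      · subst hd
        simp only [hdu, hlt, true_and, false_and, lt_irrefl, and_false, or_false, false_or, le_refl,
          and_true, hlt.le] at D ⊢
        by_cases e0 : k = 0
        · have eg : k ≠ g := by omega
          rw [ord_lin _ a i j _ {(1, -1), (0, 1)}]
          · simp [e0]; simp [show ¬ (0 = g) by omega]
          · intro v w; rw [D]; simp [e0]; omega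
        · by_cases eg : k = g
          · rw [ord_lin _ a i j _ {(-1, (k : ℤ)), (0, 1)}]
            · simp [eg, show g ≠ 0 by omega]; ring
            · intro v w; rw [D]; simp [eg, show g ≠ 0 by omega]
          · rw [ord_lin _ a i j _ {(1, -((k : ℤ) + 1)), (-1, (k : ℤ)), (0, 1)}]
            · simp [eg, e0]; ring
            · intro v w; rw [D]; simp [eg, e0]
      · simp only [hu, hd, false_and, and_false, or_false, false_or] at D ⊢
        by_cases hm : c (-1) - Ptilde g c X < Y ∧ Y < Ptilde g c X
        · rw [ord_lin _ a i j _ {(0, 1), (0, -1)}]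
          · simp
          · intro v w; rw [D]; simp [hm.1, hm.2, hm.1.le, hm.2.le]; tauto
        · rw [ord_lin _ a i j _ ∅]
          · simp
          · intro v w; rw [D]
            simp only [Finset.notMem_empty, iff_false]
            rintro ⟨-, ⟨-, h1, h2⟩ | ⟨-, h1, h2⟩⟩
            · exact hm ⟨lt_of_le_of_ne h1 (Ne.symm hd), h2⟩
            · exact hm ⟨h1, lt_of_le_of_ne h2 hu⟩
  · have hB := Reg_not_brk g c hc hg2 k X hk hr
    have n0 : X ≠ bk c 0 := fun h => hB ⟨0, by omega, h⟩
    have ng : X ≠ 0 := fun h => hB ⟨g, le_rfl, by rw [h, bk_g g c hc]⟩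
    have p0 : bk c 0 < X := lt_of_le_of_ne hX.1 n0.symm
    have pg : X < 0 := lt_of_le_of_ne hX.2 ng
    obtain ⟨hr, hl⟩ := Loc_reg g c hc hg2 k hk X hr
    have D := mem_dirs g c hc hg2 X Y
    have D := fun v w => D v w hX _ _ hr hl
    simp only [n0, ng, p0, pg, hB, true_and, false_and, and_false, or_false] at D ⊢
    by_cases hu : Y = Ptilde g c X
    · subst hu
      simp only [hud, true_and, false_and, or_false] at D
      rw [ord_lin _ a i j _ {(1, (k : ℤ)), (-1, -(k : ℤ))}]
      · simp; ring
      · intro v w; rw [D]; simp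
    · by_cases hd : Y = c (-1) - Ptilde g c X
      · subst hd
        simp only [hdu, true_and, false_and, false_or] at D
        rw [ord_lin _ a i j _ {(1, -(k : ℤ)), (-1, (k : ℤ))}]
        · simp; ring
        · intro v w; rw [D]; simp
      · rw [ord_lin _ a i j _ ∅]
        · simp
        · intro v w; rw [D]; simp [hu, hd]

end TropicalHyperelliptic

namespace TropicalHyperelliptic

lemma isRat_lin (S : Set (ℝ × ℝ)) (a : ℝ) (i j : ℤ) :
    IsRationalFn S (fun p => a + i * p.1 + j * p.2) :=
  ⟨by fun_prop, fun P _ v _ => ⟨_, hasSlope_lin S a i j P v⟩⟩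

lemma fn_x (i : ℕ) (a : ℝ) : (fun p : ℝ × ℝ => a + (i : ℝ) * p.1) =
    fun p => a + ((i : ℤ) : ℝ) * p.1 + ((0 : ℤ) : ℝ) * p.2 := by
  ext p; push_cast; ring

lemma fn_xy (i : ℕ) (b : ℝ) : (fun p : ℝ × ℝ => b + (i : ℝ) * p.1 + p.2) =
    fun p => b + ((i : ℤ) : ℝ) * p.1 + ((1 : ℤ) : ℝ) * p.2 := by
  ext p; push_cast; ring

open scoped Classical in
lemma V_ind (g : ℕ) (c : ℤ → ℝ) (hc : Hyp g c) (hg2 : 2 ≤ g) (X Y : ℝ) :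
    (Finsupp.single (V g c 0) (1 : ℤ) (X, Y) =
      if X = 0 ∧ Y = Ptilde g c X then 1 else 0) ∧
    (Finsupp.single (conj c (V g c 0)) (1 : ℤ) (X, Y) =
      if X = 0 ∧ Y = c (-1) - Ptilde g c X then 1 else 0) ∧
    (Finsupp.single (V g c g) (1 : ℤ) (X, Y) =
      if X = bk c 0 ∧ Y = Ptilde g c X then 1 else 0) ∧
    (Finsupp.single (conj c (V g c g)) (1 : ℤ) (X, Y) =
      if X = bk c 0 ∧ Y = c (-1) - Ptilde g c X then 1 else 0) := by
  rw [V_zero g c hc hg2, V_g g c hc hg2]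
  simp only [conj, Finsupp.single_apply, Prod.mk.injEq]
  refine ⟨?_, ?_, ?_, ?_⟩ <;>
  · congr 1
    apply propext
    constructor
    · rintro ⟨rfl, rfl⟩; exact ⟨rfl, rfl⟩
    · rintro ⟨rfl, rfl⟩; exact ⟨rfl, rfl⟩

lemma ord_div (g : ℕ) (c : ℤ → ℝ) (hc : Hyp g c) (hg2 : 2 ≤ g) (a : ℝ) (i j : ℤ) (P : ℝ × ℝ) :
    ord (Gam g c) (fun p => a + i * p.1 + j * p.2) P =
      i * (Finsupp.single (V g c g) (1 : ℤ) P + Finsupp.single (conj c (V g c g)) (1 : ℤ) P) +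
      (-i - j * (g + 1)) * Finsupp.single (V g c 0) (1 : ℤ) P +
      (-i + j * (g + 1)) * Finsupp.single (conj c (V g c 0)) (1 : ℤ) P := by
  obtain ⟨X, Y⟩ := P
  obtain ⟨h1, h2, h3, h4⟩ := V_ind g c hc hg2 X Y
  rw [ord_main g c hc hg2, h1, h2, h3, h4]

lemma ord_x (g : ℕ) (c : ℤ → ℝ) (hc : Hyp g c) (hg2 : 2 ≤ g) (hg : Even g) (i : ℕ) (a : ℝ)
    (P : ℝ × ℝ) :
    ord (Gam g c) (fun p => a + (i : ℝ) * p.1) P + (3 • DstarEven g c) P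
        = ((i : ℤ) • (Finsupp.single (V g c g) (1 : ℤ)
              + Finsupp.single (conj c (V g c g)) (1 : ℤ))
            + (3 * (g : ℤ) / 2 - (i : ℤ)) • (Finsupp.single (V g c 0) (1 : ℤ)
              + Finsupp.single (conj c (V g c 0)) (1 : ℤ))) P := by
  obtain ⟨h, rfl⟩ := hg
  rw [fn_x, ord_div _ c hc hg2]
  have e1 : (h + h) / 2 = h := by omega
  have e2 : 3 * ((h + h : ℕ) : ℤ) / 2 = 3 * h := by omega
  simp only [DstarEven, e1, e2, Finsupp.add_apply, Finsupp.smul_apply, smul_eq_mul, nsmul_eq_mul]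
  push_cast
  ring

lemma ord_xy (g : ℕ) (c : ℤ → ℝ) (hc : Hyp g c) (hg2 : 2 ≤ g) (hg : Even g) (i : ℕ) (b : ℝ)
    (P : ℝ × ℝ) :
    ord (Gam g c) (fun p => b + (i : ℝ) * p.1 + p.2) P + (3 • DstarEven g c) P
        = ((i : ℤ) • (Finsupp.single (V g c g) (1 : ℤ)
              + Finsupp.single (conj c (V g c g)) (1 : ℤ))
            + (5 * (g : ℤ) / 2 + 1 - (i : ℤ)) • Finsupp.single (conj c (V g c 0)) (1 : ℤ)
            + ((g : ℤ) / 2 - 1 - (i : ℤ)) • Finsupp.single (V g c 0) (1 : ℤ)) P := by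
  obtain ⟨h, rfl⟩ := hg
  rw [fn_xy, ord_div _ c hc hg2]
  have e1 : (h + h) / 2 = h := by omega
  have e2 : 5 * ((h + h : ℕ) : ℤ) / 2 = 5 * h := by omega
  have e3 : ((h + h : ℕ) : ℤ) / 2 = h := by omega
  simp only [DstarEven, e1, e2, e3, Finsupp.add_apply, Finsupp.smul_apply, smul_eq_mul,
    nsmul_eq_mul]
  push_cast
  ring

lemma single_nonneg (Q P : ℝ × ℝ) : 0 ≤ Finsupp.single Q (1 : ℤ) P := by
  classical
  rw [Finsupp.single_apply]; split_ifs <;> norm_num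

/-- the values of the four indicators at `V_0`, and membership of `V_0` in `Γ` -/
lemma at_V0 (g : ℕ) (c : ℤ → ℝ) (hc : Hyp g c) (hg2 : 2 ≤ g) :
    V g c 0 ∈ Gam g c ∧ Finsupp.single (V g c 0) (1 : ℤ) (V g c 0) = 1 ∧
    Finsupp.single (conj c (V g c 0)) (1 : ℤ) (V g c 0) = 0 ∧
    Finsupp.single (V g c g) (1 : ℤ) (V g c 0) = 0 ∧
    Finsupp.single (conj c (V g c g)) (1 : ℤ) (V g c 0) = 0 := by
  have hb0 : bk c 0 < 0 := by
    rw [← bk_g g c hc]; exact bk_lt g c hc hg2 0 g (by omega) le_rfl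
  have hp := Ptilde_ge g c hc 0
  obtain ⟨h1, h2, h3, h4⟩ := V_ind g c hc hg2 0 (Ptilde g c 0)
  rw [← V_zero g c hc hg2] at h1 h2 h3 h4
  refine ⟨?_, ?_, ?_, ?_, ?_⟩
  · rw [mem_Gam g c hc hg2, V_zero g c hc hg2]
    exact ⟨Or.inl rfl, hb0.le, le_rfl⟩
  · rw [h1]; simp
  · rw [h2, if_neg]; rintro ⟨-, h⟩; linarith
  · rw [h3, if_neg]; rintro ⟨h, -⟩; linarith
  · rw [h4, if_neg]; rintro ⟨h, -⟩; linarith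

end TropicalHyperelliptic


/-- Let `g` be even, `Γ` the bounded part of the tropical hyperelliptic curve of
genus `g`, `D* = (g/2)(V_0 + V_0′)`, and `x`, `y` the coordinate rational
functions on `Γ`.  For `i ≥ 0` and constants `a, b ∈ ℝ`:
`a + i·x ∈ R(3D*)` iff `0 ≤ i ≤ 3g/2`, and `b + i·x + y ∈ R(3D*)` iff
`0 ≤ i ≤ g/2 − 1`.  Explicitly,
`(a + i·x) + 3D* = i(V_g + V_g′) + (3g/2 − i)(V_0 + V_0′)` and
`(b + i·x + y) + 3D* = i(V_g + V_g′) + (5g/2 + 1 − i)V_0′ + (g/2 − 1 − i)V_0`. -/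
theorem monomials_in_R_three_Dstar_even (g : ℕ) (c : ℤ → ℝ) (hg : Even g)
    (hg2 : 2 ≤ g) (hc : Hyp g c) :
    (∀ (i : ℕ) (a : ℝ),
      (fun P : ℝ × ℝ => a + (i : ℝ) * P.1) ∈ RSet (Gam g c) (3 • DstarEven g c)
        ↔ i ≤ 3 * g / 2)
    ∧ (∀ (i : ℕ) (b : ℝ),
      (fun P : ℝ × ℝ => b + (i : ℝ) * P.1 + P.2) ∈ RSet (Gam g c) (3 • DstarEven g c)
        ↔ i ≤ g / 2 - 1)
    ∧ (∀ (i : ℕ) (a : ℝ) (P : ℝ × ℝ),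
      ord (Gam g c) (fun p => a + (i : ℝ) * p.1) P + (3 • DstarEven g c) P
        = ((i : ℤ) • (Finsupp.single (V g c g) (1 : ℤ)
              + Finsupp.single (conj c (V g c g)) (1 : ℤ))
            + (3 * (g : ℤ) / 2 - (i : ℤ)) • (Finsupp.single (V g c 0) (1 : ℤ)
              + Finsupp.single (conj c (V g c 0)) (1 : ℤ))) P)
    ∧ (∀ (i : ℕ) (b : ℝ) (P : ℝ × ℝ),
      ord (Gam g c) (fun p => b + (i : ℝ) * p.1 + p.2) P + (3 • DstarEven g c) P
        = ((i : ℤ) • (Finsupp.single (V g c g) (1 : ℤ)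
              + Finsupp.single (conj c (V g c g)) (1 : ℤ))
            + (5 * (g : ℤ) / 2 + 1 - (i : ℤ)) • Finsupp.single (conj c (V g c 0)) (1 : ℤ)
            + ((g : ℤ) / 2 - 1 - (i : ℤ)) • Finsupp.single (V g c 0) (1 : ℤ)) P) := by
  obtain ⟨hV, s1, s2, s3, s4⟩ := at_V0 g c hc hg2
  refine ⟨fun i a => ?_, fun i b => ?_, fun i a P => ord_x g c hc hg2 hg i a P,
    fun i b P => ord_xy g c hc hg2 hg i b P⟩
  · constructor
    · rintro ⟨-, h⟩
      have := h _ hV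
      rw [ord_x g c hc hg2 hg] at this
      simp only [Finsupp.add_apply, Finsupp.smul_apply, smul_eq_mul, s1, s2, s3, s4] at this
      omega
    · intro hi
      refine ⟨by rw [fn_x]; exact isRat_lin _ _ _ _, fun P _ => ?_⟩
      rw [ord_x g c hc hg2 hg]
      simp only [Finsupp.add_apply, Finsupp.smul_apply, smul_eq_mul]
      have n1 := single_nonneg (V g c 0) P
      have n2 := single_nonneg (conj c (V g c 0)) P
      have n3 := single_nonneg (V g c g) P
      have n4 := single_nonneg (conj c (V g c g)) P
      have : (0 : ℤ) ≤ 3 * (g : ℤ) / 2 - i := by omega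
      positivity
  · constructor
    · rintro ⟨-, h⟩
      have := h _ hV
      rw [ord_xy g c hc hg2 hg] at this
      simp only [Finsupp.add_apply, Finsupp.smul_apply, smul_eq_mul, s1, s2, s3, s4] at this
      omega
    · intro hi
      refine ⟨by rw [fn_xy]; exact isRat_lin _ _ _ _, fun P _ => ?_⟩
      rw [ord_xy g c hc hg2 hg]
      simp only [Finsupp.add_apply, Finsupp.smul_apply, smul_eq_mul]
      have n1 := single_nonneg (V g c 0) P
      have n2 := single_nonneg (conj c (V g c 0)) P
      have n3 := single_nonneg (V g c g) P
      have n4 := single_nonneg (conj c (V g c g)) P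
      have a1 : (0 : ℤ) ≤ 5 * (g : ℤ) / 2 + 1 - i := by omega
      have a2 : (0 : ℤ) ≤ (g : ℤ) / 2 - 1 - i := by omega
      positivity
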